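/- arXiv:2006.06774 — 2 statements merged into one kernel-verified Lean document; each statement's English description precedes it below -/
import Mathlib

section
/- Let 𝐰 ∈ {1,…,N}^ℕ be a q-frequency regular sequence with frequencies q = (q_1,…,q_N), let λ_1,…,λ_N and φ_1,…,φ_K be real numbers with φ_max ≠ φ_min, and let I = [φ_min Σ_{j: λ_j>0} q_j λ_j + φ_max Σ_{j: λ_j<0} q_j λ_j, φ_max Σ_{j: λ_j>0} q_j λ_j + φ_min Σ_{j: λ_j<0} q_j λ_j]. Then for every α in the interior of I, the equation Σ_{j=1}^N q_j λ_j · (Σ_{i=1}^K φ_i e^{p λ_j φ_i})/(Σ_{i=1}^K e^{p λ_j φ_i}) = α has a unique solution p ∈ ℝ, and h_top(E_𝐰(α)) = Σ_{j=1}^N q_j log Σ_{i=1}^K e^{p(λ_j φ_i − α)} for this p. Moreover, if α ∉ I then inf_{p∈ℝ} Σ_{j=1}^N q_j log Σ_{i=1}^K e^{p(λ_j φ_i − α)} = −∞. -/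
open Filter Set
open scoped ENNReal

/-- The left shift on one-sided sequence spaces. -/
def shift {α : Type*} (x : ℕ → α) : ℕ → α := fun n => x (n + 1)

/-- The cylinder set determined by a finite word `w`. -/
def cyl {α : Type*} {n : ℕ} (w : Fin n → α) : Set (ℕ → α) :=
  {x | ∀ k : Fin n, x (k : ℕ) = w k}

/-- Finite words over `α`, encoded with their length. -/
def Word (α : Type*) : Type _ := Σ n : ℕ, Fin n → α

/-- The length (level) of a word/cylinder. -/
def Word.len {α : Type*} (w : Word α) : ℕ := w.1

/-- The cylinder set of a word. -/
def Word.cylSet {α : Type*} (w : Word α) : Set (ℕ → α) := cyl w.2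

/-- `H^s_r(E)`: infimum over covers of `E` by cylinders of level `> r` of
`∑ e^{-s·l(C)}`. -/
noncomputable def Hsr {α : Type*} (E : Set (ℕ → α)) (s : ℝ) (r : ℕ) : ℝ≥0∞ :=
  ⨅ (S : Set (Word α)) (_ : ∀ w ∈ S, r < w.len) (_ : E ⊆ ⋃ w ∈ S, w.cylSet),
    ∑' w : S, ENNReal.ofReal (Real.exp (-s * ((w : Word α).len : ℝ)))

/-- `H^s(E) = lim_{r→∞} H^s_r(E)` (the quantities are nondecreasing in `r`). -/
noncomputable def Hentm {α : Type*} (E : Set (ℕ → α)) (s : ℝ) : ℝ≥0∞ :=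
  ⨆ r : ℕ, Hsr E s r

open scoped Classical in
/-- Topological entropy of `E ⊆ Σ`, with the convention `htop ∅ = -∞`. -/
noncomputable def htop {α : Type*} (E : Set (ℕ → α)) : EReal :=
  if E = ∅ then ⊥ else ((sInf {s : ℝ | 0 ≤ s ∧ Hentm E s ≠ ⊤} : ℝ) : EReal)

/-- The subshift of finite type determined by the 0-1 (Boolean) matrix `M`. -/
def SigmaA {K : ℕ} (M : Fin K → Fin K → Bool) : Set (ℕ → Fin K) :=
  {x | ∀ k : ℕ, M (x k) (x (k + 1)) = true}

/-- `Σ_A` is aperiodic and irreducible: some power of the adjacency matrix is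
strictly positive, i.e. there is `r ≥ 1` such that any two symbols are joined
by an admissible path of length `r`. -/
def ApIrr {K : ℕ} (M : Fin K → Fin K → Bool) : Prop :=
  ∃ r : ℕ, 0 < r ∧ ∀ i j : Fin K, ∃ p : ℕ → Fin K, p 0 = i ∧ p r = j ∧
    ∀ k < r, M (p k) (p (k + 1)) = true

/-- The (non-autonomous) Birkhoff average `(1/n) ∑_{k<n} φ_k(σ^k x)`. -/
noncomputable def birk {K : ℕ} (φ : ℕ → (ℕ → Fin K) → ℝ) (n : ℕ) (x : ℕ → Fin K) : ℝ :=
  (∑ k ∈ Finset.range n, φ k (shift^[k] x)) / n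

/-- The sequence of potentials `φ` has uniformly decreasing variations on `Σ_A`:
`ρ_n := sup_i sup_{|𝐢|=n} sup_{𝐣,𝐤 ∈ [𝐢]} |φ_i(𝐣) - φ_i(𝐤)| → 0`. -/
def UDV {K : ℕ} (M : Fin K → Fin K → Bool) (φ : ℕ → (ℕ → Fin K) → ℝ) : Prop :=
  ∀ ε > (0 : ℝ), ∃ N : ℕ, ∀ n ≥ N, ∀ i : ℕ, ∀ x ∈ SigmaA M, ∀ y ∈ SigmaA M,
    (∀ k < n, x k = y k) → |φ i x - φ i y| < ε

/-- `L_A(α,β)`: points of `Σ_A` with lower Birkhoff average `α` and upper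
Birkhoff average `β`. -/
def LAb {K : ℕ} (M : Fin K → Fin K → Bool) (φ : ℕ → (ℕ → Fin K) → ℝ) (a b : ℝ) :
    Set (ℕ → Fin K) :=
  {x | x ∈ SigmaA M ∧ Filter.liminf (fun n => birk φ n x) Filter.atTop = a ∧
    Filter.limsup (fun n => birk φ n x) Filter.atTop = b}

/-- `L_A(α) = L_A(α,α)`. -/
def LA {K : ℕ} (M : Fin K → Fin K → Bool) (φ : ℕ → (ℕ → Fin K) → ℝ) (a : ℝ) :
    Set (ℕ → Fin K) := LAb M φ a a

/-- `q` is a probability vector. -/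
def ProbVec {N : ℕ} (q : Fin N → ℝ) : Prop :=
  (∀ j, 0 ≤ q j) ∧ ∑ j, q j = 1

/-- `𝐰` is `q`-frequency regular: every symbol `j` occurs with asymptotic
frequency `q j`. -/
def FreqReg {N : ℕ} (w : ℕ → Fin N) (q : Fin N → ℝ) : Prop :=
  ∀ j : Fin N, Tendsto
    (fun n : ℕ => (((Finset.range (n + 1)).filter (fun k => w k = j)).card : ℝ) / n)
    atTop (nhds (q j))

/-- The level set `E_𝐰(α)` of the weighted Birkhoff average determined by the
values `f j i` (potential depending on the first coordinates). -/
def EwSet {N K : ℕ} (f : Fin N → Fin K → ℝ) (w : ℕ → Fin N) (α : ℝ) :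
    Set (ℕ → Fin K) :=
  {x | Tendsto (fun n : ℕ => (∑ k ∈ Finset.range n, f (w k) (x k)) / n) atTop (nhds α)}

/-- `φ_max`. -/
noncomputable def phiMax {K : ℕ} (φ : Fin K → ℝ) : ℝ := sSup (Set.range φ)

/-- `φ_min`. -/
noncomputable def phiMin {K : ℕ} (φ : Fin K → ℝ) : ℝ := sInf (Set.range φ)

/-- Left endpoint of the interval `I`. -/
noncomputable def loEnd {N K : ℕ} (q lam : Fin N → ℝ) (φ : Fin K → ℝ) : ℝ :=
  phiMin φ * (∑ j ∈ Finset.univ.filter (fun j => 0 < lam j), q j * lam j) +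
  phiMax φ * (∑ j ∈ Finset.univ.filter (fun j => lam j < 0), q j * lam j)

/-- Right endpoint of the interval `I`. -/
noncomputable def hiEnd {N K : ℕ} (q lam : Fin N → ℝ) (φ : Fin K → ℝ) : ℝ :=
  phiMax φ * (∑ j ∈ Finset.univ.filter (fun j => 0 < lam j), q j * lam j) +
  phiMin φ * (∑ j ∈ Finset.univ.filter (fun j => lam j < 0), q j * lam j)

/-- The function `p ↦ Σ_j q_j λ_j (Σ_i φ_i e^{pλ_jφ_i})/(Σ_i e^{pλ_jφ_i})`. -/
noncomputable def PhiDeriv {N K : ℕ} (q lam : Fin N → ℝ) (φ : Fin K → ℝ) (p : ℝ) : ℝ :=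
  ∑ j, q j * lam j *
    ((∑ i, φ i * Real.exp (p * (lam j * φ i))) / (∑ i, Real.exp (p * (lam j * φ i))))

/-- The expectation of `φ` under the Gibbs weights `exp (t * φ i)`. -/
noncomputable def gibbsMean {K : ℕ} (φ : Fin K → ℝ) (t : ℝ) : ℝ :=
  (∑ i, φ i * Real.exp (t * φ i)) / ∑ i, Real.exp (t * φ i)

lemma sum_exp_pos {K : ℕ} [NeZero K] (g : Fin K → ℝ) : 0 < ∑ i, Real.exp (g i) :=
  Finset.sum_pos (fun _ _ => Real.exp_pos _) Finset.univ_nonempty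

lemma gibbsMean_strictMono {K : ℕ} [NeZero K] {φ : Fin K → ℝ} {a b : Fin K} (hab : φ a ≠ φ b) :
    StrictMono (gibbsMean φ) := by
  intro s t hst
  unfold gibbsMean
  rw [div_lt_div_iff₀ (sum_exp_pos _) (sum_exp_pos _), ← sub_pos]
  set T : Fin K → Fin K → ℝ := fun i k =>
    (φ i - φ k) * (Real.exp (t * φ i) * Real.exp (s * φ k) -
      Real.exp (s * φ i) * Real.exp (t * φ k)) with hT
  have hnn : ∀ i k, 0 ≤ T i k ∧ (φ i ≠ φ k → 0 < T i k) := by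
    intro i k
    simp only [hT, ← Real.exp_add]
    rcases lt_trichotomy (φ i) (φ k) with h | h | h
    · have : 0 < (φ i - φ k) * (Real.exp (t * φ i + s * φ k) - Real.exp (s * φ i + t * φ k)) :=
        mul_pos_of_neg_of_neg (by linarith)
          (sub_neg.2 (Real.exp_lt_exp.2 (by nlinarith)))
      exact ⟨this.le, fun _ => this⟩
    · simp [h]
    · have : 0 < (φ i - φ k) * (Real.exp (t * φ i + s * φ k) - Real.exp (s * φ i + t * φ k)) :=
        mul_pos (by linarith) (sub_pos.2 (Real.exp_lt_exp.2 (by nlinarith)))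
      exact ⟨this.le, fun _ => this⟩
  have hpos : 0 < ∑ i, ∑ k, T i k := by
    refine Finset.sum_pos' (fun i _ => Finset.sum_nonneg fun k _ => (hnn i k).1)
      ⟨a, Finset.mem_univ _, ?_⟩
    exact Finset.sum_pos' (fun k _ => (hnn a k).1) ⟨b, Finset.mem_univ _, (hnn a b).2 hab⟩
  have hsum : ∑ i, ∑ k, T i k =
      2 * ((∑ i, φ i * Real.exp (t * φ i)) * (∑ i, Real.exp (s * φ i)) -
        (∑ i, φ i * Real.exp (s * φ i)) * ∑ i, Real.exp (t * φ i)) := by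
    have hexp : ∀ i k, T i k =
        (φ i * Real.exp (t * φ i)) * Real.exp (s * φ k)
        - (φ i * Real.exp (s * φ i)) * Real.exp (t * φ k)
        - Real.exp (t * φ i) * (φ k * Real.exp (s * φ k))
        + Real.exp (s * φ i) * (φ k * Real.exp (t * φ k)) := fun i k => by
      simp only [hT]; ring
    simp only [hexp, Finset.sum_add_distrib, Finset.sum_sub_distrib, ← Finset.sum_mul_sum]
    ring
  linarith

lemma continuous_gibbsMean {K : ℕ} [NeZero K] (φ : Fin K → ℝ) : Continuous (gibbsMean φ) := by
  unfold gibbsMean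
  exact Continuous.div (by fun_prop) (by fun_prop) fun t => (sum_exp_pos _).ne'

lemma phi_le_phiMax {K : ℕ} (φ : Fin K → ℝ) (i : Fin K) : φ i ≤ phiMax φ :=
  le_csSup (Set.finite_range φ).bddAbove ⟨i, rfl⟩

lemma phiMin_le_phi {K : ℕ} (φ : Fin K → ℝ) (i : Fin K) : phiMin φ ≤ φ i :=
  csInf_le (Set.finite_range φ).bddBelow ⟨i, rfl⟩

lemma exists_eq_phiMax {K : ℕ} [NeZero K] (φ : Fin K → ℝ) : ∃ i, φ i = phiMax φ :=
  (Set.range_nonempty φ).csSup_mem (Set.finite_range φ)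

lemma exists_eq_phiMin {K : ℕ} [NeZero K] (φ : Fin K → ℝ) : ∃ i, φ i = phiMin φ :=
  (Set.range_nonempty φ).csInf_mem (Set.finite_range φ)

lemma neZero_of_phiMax_ne_phiMin {K : ℕ} {φ : Fin K → ℝ} (h : phiMax φ ≠ phiMin φ) :
    NeZero K := by
  refine ⟨?_⟩
  rintro rfl
  exact h (by simp [phiMax, phiMin])

lemma phiMax_neg {K : ℕ} (φ : Fin K → ℝ) : phiMax (fun i => -φ i) = -phiMin φ := by
  unfold phiMax phiMin
  rw [Real.sInf_def, neg_neg]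
  congr 1
  ext x
  simp [neg_eq_iff_eq_neg]

lemma gibbsMean_neg {K : ℕ} (φ : Fin K → ℝ) (t : ℝ) :
    gibbsMean (fun i => -φ i) t = -gibbsMean φ (-t) := by
  simp [gibbsMean, neg_div]

lemma tendsto_gibbsMean_atTop {K : ℕ} [NeZero K] (φ : Fin K → ℝ) :
    Tendsto (gibbsMean φ) atTop (nhds (phiMax φ)) := by
  set M := phiMax φ with hM
  have hlim : ∀ i, Tendsto (fun t : ℝ => Real.exp (t * (φ i - M))) atTop
      (nhds (if φ i = M then 1 else 0)) := by
    intro i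
    split_ifs with h
    · simp [h]
    · have hlt : φ i - M < 0 := sub_neg.2 (lt_of_le_of_ne (phi_le_phiMax φ i) h)
      exact Real.tendsto_exp_atBot.comp (tendsto_id.atTop_mul_const_of_neg hlt)
  have hcard : (∑ i, if φ i = M then (1 : ℝ) else 0) ≠ 0 := by
    obtain ⟨a, ha⟩ := exists_eq_phiMax φ
    refine (Finset.sum_pos' (fun i _ => by split_ifs <;> norm_num)
      ⟨a, Finset.mem_univ _, ?_⟩).ne'
    simp [ha, hM]
  have hquot := (tendsto_finsetSum Finset.univ fun i _ => (hlim i).const_mul (φ i)).div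
    (tendsto_finsetSum Finset.univ fun i _ => hlim i) hcard
  have hval : (∑ i, φ i * (if φ i = M then (1 : ℝ) else 0)) /
      (∑ i, if φ i = M then (1 : ℝ) else 0) = M := by
    rw [div_eq_iff hcard, Finset.mul_sum]
    refine Finset.sum_congr rfl fun i _ => ?_
    split_ifs with h
    · rw [h]
    · simp
  rw [hval] at hquot
  refine hquot.congr fun t => ?_
  have hfac : ∀ i, Real.exp (t * (φ i - M)) = Real.exp (t * φ i) * Real.exp (-(t * M)) := by
    intro i
    rw [← Real.exp_add]
    ring_nf
  simp only [Pi.div_apply, gibbsMean, hfac, ← mul_assoc, ← Finset.sum_mul]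
  exact mul_div_mul_right _ _ (Real.exp_pos _).ne'

lemma tendsto_gibbsMean_atBot {K : ℕ} [NeZero K] (φ : Fin K → ℝ) :
    Tendsto (gibbsMean φ) atBot (nhds (phiMin φ)) := by
  have h := ((tendsto_gibbsMean_atTop fun i => -φ i).comp tendsto_neg_atBot_atTop).neg
  rw [phiMax_neg, neg_neg] at h
  refine h.congr fun t => ?_
  simp [gibbsMean_neg]

lemma phiDeriv_eq {N K : ℕ} (q lam : Fin N → ℝ) (φ : Fin K → ℝ) (p : ℝ) :
    PhiDeriv q lam φ p = ∑ j, q j * (lam j * gibbsMean φ (p * lam j)) := by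
  simp only [PhiDeriv, gibbsMean, mul_assoc]

lemma hiEnd_eq {N K : ℕ} (q lam : Fin N → ℝ) (φ : Fin K → ℝ) :
    hiEnd q lam φ =
      ∑ j, q j * (lam j * if 0 < lam j then phiMax φ else phiMin φ) := by
  simp only [hiEnd, Finset.sum_filter, Finset.mul_sum, ← Finset.sum_add_distrib]
  refine Finset.sum_congr rfl fun j _ => ?_
  rcases lt_trichotomy (lam j) 0 with h | h | h
  · simp [h, h.not_gt]; ring
  · simp [h]
  · simp [h, h.not_gt]; ring

lemma loEnd_eq_neg_hiEnd {N K : ℕ} (q lam : Fin N → ℝ) (φ : Fin K → ℝ) :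
    loEnd q lam φ = -hiEnd q (fun j => -lam j) φ := by
  simp only [loEnd, hiEnd, Left.neg_pos_iff, Left.neg_neg_iff, mul_neg, Finset.sum_neg_distrib]
  ring

lemma phiDeriv_neg {N K : ℕ} (q lam : Fin N → ℝ) (φ : Fin K → ℝ) (p : ℝ) :
    PhiDeriv q (fun j => -lam j) φ (-p) = -PhiDeriv q lam φ p := by
  simp [PhiDeriv]

lemma tendsto_phiDeriv_atTop {N K : ℕ} [NeZero K] (q lam : Fin N → ℝ) (φ : Fin K → ℝ) :
    Tendsto (PhiDeriv q lam φ) atTop (nhds (hiEnd q lam φ)) := by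
  rw [hiEnd_eq, funext (phiDeriv_eq q lam φ)]
  refine tendsto_finsetSum _ fun j _ => Tendsto.const_mul _ ?_
  rcases lt_trichotomy (lam j) 0 with h | h | h
  · rw [if_neg h.not_gt]
    exact ((tendsto_gibbsMean_atBot φ).comp (tendsto_id.atTop_mul_const_of_neg h)).const_mul _
  · simp [h]
  · rw [if_pos h]
    exact ((tendsto_gibbsMean_atTop φ).comp (tendsto_id.atTop_mul_const h)).const_mul _

lemma tendsto_phiDeriv_atBot {N K : ℕ} [NeZero K] (q lam : Fin N → ℝ) (φ : Fin K → ℝ) :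
    Tendsto (PhiDeriv q lam φ) atBot (nhds (loEnd q lam φ)) := by
  rw [loEnd_eq_neg_hiEnd]
  refine ((tendsto_phiDeriv_atTop q (fun j => -lam j) φ).comp tendsto_neg_atBot_atTop).neg.congr
    fun p => ?_
  simp [phiDeriv_neg]

lemma continuous_phiDeriv {N K : ℕ} [NeZero K] (q lam : Fin N → ℝ) (φ : Fin K → ℝ) :
    Continuous (PhiDeriv q lam φ) := by
  rw [funext (phiDeriv_eq q lam φ)]
  have := continuous_gibbsMean φ
  fun_prop

lemma phiDeriv_strictMono {N K : ℕ} [NeZero K] {q lam : Fin N → ℝ} {φ : Fin K → ℝ}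
    (hq : ∀ j, 0 ≤ q j) (hφ : phiMax φ ≠ phiMin φ) {l : Fin N} (hl : q l * lam l ≠ 0) :
    StrictMono (PhiDeriv q lam φ) := by
  obtain ⟨a, ha⟩ := exists_eq_phiMax φ
  obtain ⟨b, hb⟩ := exists_eq_phiMin φ
  have hmono := gibbsMean_strictMono (φ := φ) (a := a) (b := b) (by rwa [ha, hb])
  intro s t hst
  have key : ∀ j, lam j ≠ 0 →
      lam j * gibbsMean φ (s * lam j) < lam j * gibbsMean φ (t * lam j) := by
    intro j hj
    rcases hj.lt_or_gt with h | h
    · exact mul_lt_mul_of_neg_left (hmono (mul_lt_mul_of_neg_right hst h)) h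
    · exact mul_lt_mul_of_pos_left (hmono (mul_lt_mul_of_pos_right hst h)) h
  rw [phiDeriv_eq, phiDeriv_eq]
  refine Finset.sum_lt_sum (fun j _ => mul_le_mul_of_nonneg_left ?_ (hq j))
    ⟨l, Finset.mem_univ _, mul_lt_mul_of_pos_left (key l (right_ne_zero_of_mul hl))
      ((hq l).lt_of_ne' (left_ne_zero_of_mul hl))⟩
  by_cases h : lam j = 0
  · simp [h]
  · exact (key j h).le

lemma existsUnique_phiDeriv_eq {N K : ℕ} {q lam : Fin N → ℝ} {φ : Fin K → ℝ}
    (hq : ∀ j, 0 ≤ q j) (hφ : phiMax φ ≠ phiMin φ) {α : ℝ}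
    (hα : α ∈ Set.Ioo (loEnd q lam φ) (hiEnd q lam φ)) :
    ∃! p : ℝ, PhiDeriv q lam φ p = α := by
  have := neZero_of_phiMax_ne_phiMin hφ
  obtain ⟨l, hl⟩ : ∃ l, q l * lam l ≠ 0 := by
    by_contra! h
    have := hα.1.trans hα.2
    simp [loEnd, hiEnd, h] at this
  obtain ⟨a, ha⟩ := ((tendsto_phiDeriv_atBot q lam φ).eventually_lt_const hα.1).exists
  obtain ⟨b, hb⟩ := ((tendsto_phiDeriv_atTop q lam φ).eventually_const_lt hα.2).exists
  obtain ⟨p, hp⟩ := mem_range_of_exists_le_of_exists_ge (continuous_phiDeriv q lam φ)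
    ⟨a, ha.le⟩ ⟨b, hb.le⟩
  exact ⟨p, hp, fun p' hp' => (phiDeriv_strictMono hq hφ hl).injective (hp'.trans hp.symm)⟩

lemma pressure_le {N K : ℕ} [NeZero K] {q lam : Fin N → ℝ} (hq : ProbVec q) (φ : Fin K → ℝ)
    (α : ℝ) {p : ℝ} (hp : 0 ≤ p) :
    ∑ j, q j * Real.log (∑ i, Real.exp (p * (lam j * φ i - α))) ≤
      Real.log K + p * (hiEnd q lam φ - α) := by
  have hK : (0 : ℝ) < K := Nat.cast_pos.2 (NeZero.pos K)
  set h : Fin N → ℝ := fun j => lam j * if 0 < lam j then phiMax φ else phiMin φ with hh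
  have hle : ∀ j i, lam j * φ i ≤ h j := by
    intro j i
    simp only [hh]
    split_ifs with hj
    · exact mul_le_mul_of_nonneg_left (phi_le_phiMax φ i) hj.le
    · exact mul_le_mul_of_nonpos_left (phiMin_le_phi φ i) (not_lt.1 hj)
  have hlog : ∀ j, Real.log (∑ i, Real.exp (p * (lam j * φ i - α))) ≤
      Real.log K + p * (h j - α) := by
    intro j
    rw [← Real.log_exp (p * (h j - α)), ← Real.log_mul hK.ne' (Real.exp_pos _).ne']
    refine Real.log_le_log (sum_exp_pos _) ?_
    refine (Finset.sum_le_card_nsmul _ _ (Real.exp (p * (h j - α))) fun i _ => ?_).trans ?_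
    · exact Real.exp_le_exp.2 (mul_le_mul_of_nonneg_left (by linarith [hle j i]) hp)
    · simp
  calc _ ≤ ∑ j, q j * (Real.log K + p * (h j - α)) :=
        Finset.sum_le_sum fun j _ => mul_le_mul_of_nonneg_left (hlog j) (hq.1 j)
    _ = (∑ j, q j) * (Real.log K - p * α) + p * ∑ j, q j * h j := by
        rw [Finset.sum_mul, Finset.mul_sum, ← Finset.sum_add_distrib]
        exact Finset.sum_congr rfl fun j _ => by ring
    _ = _ := by rw [hq.2, hiEnd_eq]; ring

lemma exists_pressure_lt {N K : ℕ} [NeZero K] {q lam : Fin N → ℝ} (hq : ProbVec q)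
    (φ : Fin K → ℝ) {α : ℝ} (hα : hiEnd q lam φ < α) (c : ℝ) :
    ∃ p : ℝ, ∑ j, q j * Real.log (∑ i, Real.exp (p * (lam j * φ i - α))) < c := by
  have hlim : Tendsto (fun p : ℝ => Real.log K + p * (hiEnd q lam φ - α)) atTop atBot :=
    tendsto_atBot_add_const_left _ _ (tendsto_id.atTop_mul_const_of_neg (sub_neg.2 hα))
  obtain ⟨p, hp, hp0⟩ := ((hlim.eventually_lt_atBot c).and (eventually_ge_atTop 0)).exists
  exact ⟨p, (pressure_le hq φ α hp0).trans_lt hp⟩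

lemma iInf_pressure_eq_bot {N K : ℕ} [NeZero K] {q lam : Fin N → ℝ} (hq : ProbVec q)
    (φ : Fin K → ℝ) {α : ℝ} (hα : α ∉ Set.Icc (loEnd q lam φ) (hiEnd q lam φ)) :
    (⨅ p : ℝ, ((∑ j, q j * Real.log (∑ i, Real.exp (p * (lam j * φ i - α))) : ℝ) : EReal))
      = ⊥ := by
  refine EReal.eq_bot_iff_forall_lt _ |>.2 fun c => ?_
  obtain ⟨p, hp⟩ : ∃ p : ℝ,
      ∑ j, q j * Real.log (∑ i, Real.exp (p * (lam j * φ i - α))) < c := by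
    by_cases h : hiEnd q lam φ < α
    · exact exists_pressure_lt hq φ h c
    · have hlo : α < loEnd q lam φ := by
        by_contra! h'
        exact hα ⟨h', not_lt.1 h⟩
      rw [loEnd_eq_neg_hiEnd] at hlo
      obtain ⟨p, hp⟩ := exists_pressure_lt (lam := fun j => -lam j) (α := -α) hq φ
        (by linarith) c
      refine ⟨-p, ?_⟩
      have hflip : ∀ j i, -p * (lam j * φ i - α) = p * (-lam j * φ i - -α) := fun j i => by ring
      simpa only [hflip] using hp
  exact (iInf_le _ p).trans_lt (EReal.coe_lt_coe_iff.2 hp)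

lemma FreqReg.tendsto_average {N : ℕ} {w : ℕ → Fin N} {q : Fin N → ℝ} (hw : FreqReg w q)
    (g : Fin N → ℝ) :
    Tendsto (fun n : ℕ => (∑ k ∈ Finset.range n, g (w k)) / n) atTop
      (nhds (∑ j, q j * g j)) := by
  have hcount : ∀ j, Tendsto
      (fun n : ℕ => (((Finset.range n).filter (fun k => w k = j)).card : ℝ) / n)
      atTop (nhds (q j)) := by
    intro j
    have hlast : Tendsto (fun n : ℕ => (if w n = j then (1 : ℝ) else 0) / n) atTop (nhds 0) := by
      refine squeeze_zero (fun n => by split_ifs <;> positivity) (fun n => ?_)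
        tendsto_one_div_atTop_nhds_zero_nat
      gcongr
      split_ifs <;> norm_num
    have h := (hw j).sub hlast
    rw [sub_zero] at h
    refine h.congr fun n => ?_
    rw [← sub_div]
    congr 1
    simp only [Finset.card_filter, Nat.cast_sum, Finset.sum_range_succ]
    push_cast
    ring
  refine (tendsto_finsetSum Finset.univ fun j _ => (hcount j).mul_const (g j)).congr fun n => ?_
  simp only [Finset.card_filter, Nat.cast_sum, div_mul_eq_mul_div, ← Finset.sum_div,
    Finset.sum_mul]
  rw [Finset.sum_comm]
  simp

lemma tsum_ofReal_exp_ne_top {δ : ℝ} (hδ : 0 < δ) :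
    ∑' n : ℕ, ENNReal.ofReal (Real.exp (-δ * n)) ≠ ⊤ := by
  have h : Summable fun n : ℕ => Real.exp (n * -δ) :=
    Real.summable_exp_nat_mul_iff.2 (neg_lt_zero.2 hδ)
  exact (h.congr fun n => by rw [mul_comm]).tsum_ofReal_ne_top

lemma sum_prod_words_eq_one {K : ℕ} {π : ℕ → Fin K → ℝ} (hπ1 : ∀ k, ∑ i, π k i = 1) (n : ℕ) :
    ∑ u : Fin n → Fin K, ∏ k : Fin n, π k (u k) = 1 := by
  have h := Finset.prod_univ_sum (fun _ : Fin n => (Finset.univ : Finset (Fin K)))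
    (fun k i => π k i)
  simp only [hπ1, Finset.prod_const_one, Fintype.piFinset_univ] at h
  exact h.symm

/-- If every point of `E` has infinitely many prefixes of mass at least `exp (-s n)` for a
product of probability vectors, then the entropy measures of `E` of order `> s` are finite. -/
lemma Hentm_ne_top_of_le_prod {K : ℕ} {π : ℕ → Fin K → ℝ} (hπ : ∀ k i, 0 ≤ π k i)
    (hπ1 : ∀ k, ∑ i, π k i = 1) {E : Set (ℕ → Fin K)} {s t : ℝ} (hst : s < t)
    (hE : ∀ x ∈ E, ∀ r : ℕ, ∃ n > r, Real.exp (-s * n) ≤ ∏ k ∈ Finset.range n, π k (x k)) :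
    Hentm E t ≠ ⊤ := by
  refine ne_top_of_le_ne_top (tsum_ofReal_exp_ne_top (sub_pos.2 hst)) (iSup_le fun r => ?_)
  set S : Set (Word (Fin K)) :=
    {W | r < W.len ∧ Real.exp (-s * W.len) ≤ ∏ k : Fin W.1, π k (W.2 k)} with hS
  have hcov : E ⊆ ⋃ W ∈ S, W.cylSet := by
    intro x hx
    obtain ⟨n, hn, hle⟩ := hE x hx r
    rw [← Fin.prod_univ_eq_prod_range (fun k => π k (x k))] at hle
    exact mem_biUnion (x := (⟨n, fun k => x k⟩ : Word (Fin K))) ⟨hn, hle⟩ fun _ => rfl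
  set g : Word (Fin K) → ℝ≥0∞ := fun W =>
    ENNReal.ofReal (Real.exp (-(t - s) * W.len) * ∏ k : Fin W.1, π k (W.2 k)) with hg
  calc Hsr E t r ≤ ∑' W : S, ENNReal.ofReal (Real.exp (-t * ((W : Word (Fin K)).len : ℝ))) :=
        iInf_le_of_le S (iInf_le_of_le (fun W hW => hW.1) (iInf_le_of_le hcov le_rfl))
    _ ≤ ∑' W : S, g W := by
        refine ENNReal.tsum_le_tsum fun W => ENNReal.ofReal_le_ofReal ?_
        refine le_trans (le_of_eq ?_)
          (mul_le_mul_of_nonneg_left W.2.2 (Real.exp_pos _).le)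
        rw [← Real.exp_add]
        ring_nf
    _ ≤ ∑' W, g W := ENNReal.tsum_comp_le_tsum_of_injective Subtype.val_injective g
    _ = ∑' (n : ℕ) (u : Fin n → Fin K),
          ENNReal.ofReal (Real.exp (-(t - s) * n) * ∏ k : Fin n, π k (u k)) :=
        ENNReal.tsum_sigma' (β := fun n => Fin n → Fin K) g
    _ = ∑' n : ℕ, ENNReal.ofReal (Real.exp (-(t - s) * n)) := by
        refine tsum_congr fun n => ?_
        rw [tsum_fintype, ← ENNReal.ofReal_sum_of_nonneg fun u _ =>
          mul_nonneg (Real.exp_pos _).le (Finset.prod_nonneg fun k _ => hπ _ _),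
          ← Finset.mul_sum, sum_prod_words_eq_one hπ1, mul_one]

open MeasureTheory in
/-- The mass distribution principle: a set of positive measure all of whose points have prefixes
of measure at most `exp (-s n)` has infinite entropy measures of every order `< s`. -/
lemma Hentm_eq_top_of_measure_le {α : Type*} [Countable α] [MeasurableSpace α]
    (μ : Measure (ℕ → α))
    {E : Set (ℕ → α)} (hμE : μ E ≠ 0) {s t : ℝ} (hts : t < s)
    (hE : ∀ x ∈ E, ∀ᶠ n : ℕ in atTop,
      μ {y | ∀ k < n, y k = x k} ≤ ENNReal.ofReal (Real.exp (-s * n))) :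
    Hentm E t = ⊤ := by
  set F : ℕ → Set (ℕ → α) := fun m => {x ∈ E | ∀ n ≥ m,
    μ {y | ∀ k < n, y k = x k} ≤ ENNReal.ofReal (Real.exp (-s * n))} with hF
  obtain ⟨m, hm⟩ : ∃ m, μ (F m) ≠ 0 := by
    by_contra! h
    refine hμE (measure_mono_null (fun x hx => ?_) (measure_iUnion_null h))
    obtain ⟨m, hm⟩ := eventually_atTop.1 (hE x hx)
    exact mem_iUnion.2 ⟨m, hx, hm⟩
  have hcount : Countable (Word α) := inferInstanceAs (Countable (Σ n : ℕ, Fin n → α))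
  have hbound : ∀ r ≥ m, μ (F m) * ENNReal.ofReal (Real.exp ((s - t) * r)) ≤ Hsr E t r := by
    intro r hr
    refine le_iInf fun S => le_iInf fun hlen => le_iInf fun hcov => ?_
    have hpiece : ∀ W : S, μ (F m ∩ (W : Word α).cylSet) *
        ENNReal.ofReal (Real.exp ((s - t) * r)) ≤
          ENNReal.ofReal (Real.exp (-t * ((W : Word α).len : ℝ))) := by
      intro W
      rcases (F m ∩ (W : Word α).cylSet).eq_empty_or_nonempty with h0 | ⟨x, hxF, hxW⟩
      · simp [h0]
      have hrl : r < (W : Word α).len := hlen _ W.2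
      have hsub : F m ∩ (W : Word α).cylSet ⊆ {y | ∀ k < (W : Word α).len, y k = x k} :=
        fun y hy k hk => (hy.2 ⟨k, hk⟩).trans (hxW ⟨k, hk⟩).symm
      refine (mul_le_mul_left ((measure_mono hsub).trans
        (hxF.2 _ (hr.trans hrl.le))) _).trans ?_
      rw [← ENNReal.ofReal_mul (Real.exp_pos _).le, ← Real.exp_add]
      refine ENNReal.ofReal_le_ofReal (Real.exp_le_exp.2 ?_)
      have : (r : ℝ) < (W : Word α).len := Nat.cast_lt.2 hrl
      nlinarith
    have hFcov : F m ⊆ ⋃ W : S, F m ∩ (W : Word α).cylSet := by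
      intro x hx
      obtain ⟨W, hW, hxW⟩ := mem_iUnion₂.1 (hcov hx.1)
      exact mem_iUnion.2 ⟨⟨W, hW⟩, hx, hxW⟩
    calc _ ≤ (∑' W : S, μ (F m ∩ (W : Word α).cylSet)) *
          ENNReal.ofReal (Real.exp ((s - t) * r)) :=
          mul_le_mul_left ((measure_mono hFcov).trans (measure_iUnion_le _)) _
      _ ≤ _ := by
          rw [← ENNReal.tsum_mul_right]
          exact ENNReal.tsum_le_tsum hpiece
  have hlim : Tendsto (fun r : ℕ => μ (F m) * ENNReal.ofReal (Real.exp ((s - t) * r))) atTop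
      (nhds ⊤) := by
    have hexp : Tendsto (fun r : ℕ => Real.exp ((s - t) * r)) atTop atTop :=
      Real.tendsto_exp_atTop.comp
        (tendsto_natCast_atTop_atTop.const_mul_atTop (sub_pos.2 hts))
    have h := ENNReal.Tendsto.const_mul (a := μ (F m))
      (ENNReal.tendsto_ofReal_atTop.comp hexp) (Or.inl ENNReal.top_ne_zero)
    rwa [ENNReal.mul_top hm] at h
  refine top_le_iff.1 (le_of_tendsto hlim ?_)
  filter_upwards [eventually_ge_atTop m] with r hr
  exact (hbound r hr).trans (le_iSup (Hsr E t) r)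

open MeasureTheory ProbabilityTheory in
lemma ae_eventually_sum_lt {Ω : Type*} {mΩ : MeasurableSpace Ω} {μ : Measure Ω}
    [IsProbabilityMeasure μ] {Y : ℕ → Ω → ℝ} (hind : iIndepFun Y μ) {c : NNReal} (hc : 0 < c)
    (hY : ∀ k, HasSubgaussianMGF (Y k) c μ) {ε : ℝ} (hε : 0 < ε) :
    ∀ᵐ ω ∂μ, ∀ᶠ n : ℕ in atTop, ∑ k ∈ Finset.range n, Y k ω < ε * n := by
  have hc' : (0 : ℝ) < c := hc
  have hsum : ∑' n : ℕ, μ {ω | ε * n ≤ ∑ k ∈ Finset.range n, Y k ω} ≠ ⊤ := by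
    refine ne_top_of_le_ne_top
      (tsum_ofReal_exp_ne_top (δ := ε ^ 2 / (2 * c)) (by positivity))
      (ENNReal.tsum_le_tsum fun n => ?_)
    rw [← ofReal_measureReal]
    refine ENNReal.ofReal_le_ofReal
      ((HasSubgaussianMGF.measure_sum_range_ge_le_of_iIndepFun hind (fun k _ => hY k)
        (by positivity)).trans (Real.exp_le_exp.2 (le_of_eq ?_)))
    rcases eq_or_ne (n : ℝ) 0 with h | h
    · simp [h]
    · field_simp
  filter_upwards [ae_eventually_notMem hsum] with ω hω
  filter_upwards [hω] with n hn
  simpa using hn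

open MeasureTheory ProbabilityTheory in
/-- A strong law of large numbers for independent, uniformly sub-Gaussian random variables. -/
lemma ae_tendsto_average_of_hasSubgaussianMGF {Ω : Type*} {mΩ : MeasurableSpace Ω}
    {μ : Measure Ω} [IsProbabilityMeasure μ] {Y : ℕ → Ω → ℝ} (hind : iIndepFun Y μ)
    {c : NNReal} (hc : 0 < c) (hY : ∀ k, HasSubgaussianMGF (Y k) c μ) :
    ∀ᵐ ω ∂μ, Tendsto (fun n : ℕ => (∑ k ∈ Finset.range n, Y k ω) / n) atTop (nhds 0) := by
  have hneg : iIndepFun (fun k ω => -Y k ω) μ := hind.comp (fun _ y => -y) fun _ => measurable_neg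
  have hpos : ∀ m : ℕ, (0 : ℝ) < 1 / (m + 1) := fun m => by positivity
  have h₁ := ae_all_iff.2 fun m : ℕ => ae_eventually_sum_lt hind hc hY (hpos m)
  have h₂ := ae_all_iff.2 fun m : ℕ =>
    ae_eventually_sum_lt hneg hc (fun k => (hY k).neg) (hpos m)
  filter_upwards [h₁, h₂] with ω hω₁ hω₂
  rw [Metric.tendsto_atTop']
  intro ε hε
  obtain ⟨m, hm⟩ := exists_nat_one_div_lt hε
  obtain ⟨n₀, hn₀⟩ := eventually_atTop.1 ((hω₁ m).and (hω₂ m))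
  refine ⟨n₀, fun n hn => ?_⟩
  obtain ⟨hu, hl⟩ := hn₀ n hn.le
  have hn' : (0 : ℝ) < n := Nat.cast_pos.2 (by lia)
  rw [Finset.sum_neg_distrib] at hl
  rw [Real.dist_eq, sub_zero, abs_div, abs_of_pos hn', div_lt_iff₀ hn', abs_lt]
  constructor <;> nlinarith

open MeasureTheory ProbabilityTheory in
lemma ae_tendsto_average_infinitePi {ι : Type*} [MeasurableSpace ι]
    [MeasurableSingletonClass ι] [Countable ι]
    (P : ℕ → Measure ι) [∀ k, IsProbabilityMeasure (P k)] {X : ℕ → ι → ℝ} {B : ℝ}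
    (hX : ∀ k i, |X k i| ≤ B) :
    ∀ᵐ x ∂Measure.infinitePi P,
      Tendsto (fun n : ℕ => (∑ k ∈ Finset.range n, (X k (x k) - ∫ i, X k i ∂P k)) / n) atTop
        (nhds 0) := by
  set B' := |B| + 1
  have hB' : 0 < B' := by positivity
  have hmeas : ∀ k, Measurable (X k) := fun k => measurable_of_countable _
  have hmeas' : ∀ k, Measurable fun i => X k i - ∫ i, X k i ∂P k :=
    fun k => measurable_of_countable _
  refine ae_tendsto_average_of_hasSubgaussianMGF
    (iIndepFun_infinitePi (P := P) (X := fun k i => X k i - ∫ i, X k i ∂P k) hmeas')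
    (c := (‖B' - (-B')‖₊ / 2) ^ 2) ?_ fun k => ?_
  · exact pow_pos (half_pos (nnnorm_pos.2 (by linarith))) 2
  · have h := hasSubgaussianMGF_of_mem_Icc (μ := Measure.infinitePi P) (a := -B') (b := B')
      (X := fun x => X k (x k)) ((hmeas k).comp (measurable_pi_apply k)).aemeasurable
      (.of_forall fun x => abs_le.1 ((hX k _).trans (by linarith [le_abs_self B])))
    have hint : ∫ x, X k (x k) ∂Measure.infinitePi P = ∫ i, X k i ∂P k :=
      (measurePreserving_eval_infinitePi P k).hasLaw.integral_comp
        (hmeas k).aestronglyMeasurable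
    rwa [hint] at h

open MeasureTheory in
lemma exists_measure_of_probVec {K : ℕ} {v : Fin K → ℝ} (hv : ProbVec v) :
    ∃ P : Measure (Fin K), IsProbabilityMeasure P ∧ (∀ i, P {i} = ENNReal.ofReal (v i)) ∧
      ∀ g : Fin K → ℝ, ∫ i, g i ∂P = ∑ i, v i * g i := by
  refine ⟨(PMF.ofFintype (fun i => ENNReal.ofReal (v i)) ?_).toMeasure, inferInstance,
    fun i => ?_, fun g => ?_⟩
  · rw [← ENNReal.ofReal_sum_of_nonneg fun i _ => hv.1 i, hv.2, ENNReal.ofReal_one]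
  · rw [PMF.toMeasure_apply_singleton _ _ (measurableSet_singleton i), PMF.ofFintype_apply]
  · simp [PMF.integral_eq_sum, ENNReal.toReal_ofReal (hv.1 _)]

/-- The Gibbs probability vector with weights proportional to `exp (p * g i)`. -/
noncomputable def gibbsVec {K : ℕ} (p : ℝ) (g : Fin K → ℝ) (i : Fin K) : ℝ :=
  Real.exp (p * g i) / ∑ l, Real.exp (p * g l)

lemma probVec_gibbsVec {K : ℕ} [NeZero K] (p : ℝ) (g : Fin K → ℝ) : ProbVec (gibbsVec p g) := by
  refine ⟨fun i => div_nonneg (Real.exp_pos _).le (sum_exp_pos _).le, ?_⟩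
  simp only [gibbsVec, ← Finset.sum_div]
  exact div_self (sum_exp_pos _).ne'

lemma prod_gibbsVec {K : ℕ} [NeZero K] (p : ℝ) (g : ℕ → Fin K → ℝ) (x : ℕ → Fin K) (n : ℕ) :
    ∏ k ∈ Finset.range n, gibbsVec p (g k) (x k) =
      Real.exp (p * ∑ k ∈ Finset.range n, g k (x k) -
        ∑ k ∈ Finset.range n, Real.log (∑ i, Real.exp (p * g k i))) := by
  rw [Finset.mul_sum, ← Finset.sum_sub_distrib, Real.exp_sum]
  refine Finset.prod_congr rfl fun k _ => ?_
  rw [Real.exp_sub, Real.exp_log (sum_exp_pos _), gibbsVec]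

lemma log_sum_exp_sub {K : ℕ} [NeZero K] (p α : ℝ) (g : Fin K → ℝ) :
    Real.log (∑ i, Real.exp (p * (g i - α))) =
      Real.log (∑ i, Real.exp (p * g i)) - p * α := by
  simp only [mul_sub, Real.exp_sub, ← Finset.sum_div]
  rw [Real.log_div (sum_exp_pos _).ne' (Real.exp_pos _).ne', Real.log_exp]

/-- On the level set, the Gibbs mass of prefixes decays at the exponential rate given by the
pressure. -/
lemma tendsto_log_gibbs_of_mem_EwSet {N K : ℕ} [NeZero K] {q : Fin N → ℝ} (hq : ProbVec q)
    {w : ℕ → Fin N} (hw : FreqReg w q) (f : Fin N → Fin K → ℝ) (p α : ℝ) {x : ℕ → Fin K}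
    (hx : x ∈ EwSet f w α) :
    Tendsto (fun n : ℕ => (p * ∑ k ∈ Finset.range n, f (w k) (x k) -
        ∑ k ∈ Finset.range n, Real.log (∑ i, Real.exp (p * f (w k) i))) / n) atTop
      (nhds (-∑ j, q j * Real.log (∑ i, Real.exp (p * (f j i - α))))) := by
  have hval : -∑ j, q j * Real.log (∑ i, Real.exp (p * (f j i - α))) =
      p * α - ∑ j, q j * Real.log (∑ i, Real.exp (p * f j i)) := by
    simp only [log_sum_exp_sub]
    simp only [mul_sub, Finset.sum_sub_distrib, ← Finset.sum_mul, hq.2]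
    ring
  rw [hval]
  have hx' : Tendsto _ _ _ := hx
  refine ((hx'.const_mul p).sub
    (hw.tendsto_average fun j => Real.log (∑ i, Real.exp (p * f j i)))).congr fun n => ?_
  rw [sub_div, mul_div_assoc]

open MeasureTheory in
/-- The product of Gibbs measures along `w` charges the level set of its mean. -/
lemma exists_gibbs_measure {N K : ℕ} [NeZero K] {q : Fin N → ℝ}
    {w : ℕ → Fin N} (hw : FreqReg w q) (f : Fin N → Fin K → ℝ) {p α : ℝ}
    (hα : ∑ j, q j * ∑ i, gibbsVec p (f j) i * f j i = α) :
    ∃ μ : Measure (ℕ → Fin K), μ (EwSet f w α) ≠ 0 ∧ ∀ (x : ℕ → Fin K) (n : ℕ),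
      μ {y | ∀ k < n, y k = x k} =
        ENNReal.ofReal (∏ k ∈ Finset.range n, gibbsVec p (f (w k)) (x k)) := by
  choose P hP hPs hPi using fun k : ℕ =>
    exists_measure_of_probVec (probVec_gibbsVec p (f (w k)))
  refine ⟨Measure.infinitePi P, ?_, fun x n => ?_⟩
  · have hB : ∀ k i, |f (w k) i| ≤ ∑ j, ∑ i, |f j i| := fun k i =>
      (Finset.single_le_sum (f := fun i => |f (w k) i|) (fun _ _ => abs_nonneg _)
        (Finset.mem_univ i)).trans
      (Finset.single_le_sum (f := fun j => ∑ i, |f j i|)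
        (fun _ _ => Finset.sum_nonneg fun _ _ => abs_nonneg _) (Finset.mem_univ (w k)))
    have hae : ∀ᵐ x ∂Measure.infinitePi P, x ∈ EwSet f w α := by
      filter_upwards [ae_tendsto_average_infinitePi P hB] with x hx
      have h := hx.add (hw.tendsto_average fun j => ∑ i, gibbsVec p (f j) i * f j i)
      rw [hα, zero_add] at h
      refine h.congr fun n => ?_
      simp only [hPi, Finset.sum_sub_distrib]
      ring
    intro h0
    obtain ⟨x, hx, hx'⟩ := (hae.and (measure_eq_zero_iff_ae_notMem.1 h0)).exists
    exact hx' hx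
  · have hset : {y : ℕ → Fin K | ∀ k < n, y k = x k} =
        Set.pi (Finset.range n : Set ℕ) fun k => {x k} := by
      ext y
      simp [Set.mem_pi]
    rw [hset, Measure.infinitePi_pi P fun k _ => measurableSet_singleton _,
      ENNReal.ofReal_prod_of_nonneg fun k _ => (probVec_gibbsVec p _).1 _]
    exact Finset.prod_congr rfl fun k _ => hPs k _

lemma htop_EwSet_eq {N K : ℕ} [NeZero K] {q : Fin N → ℝ} (hq : ProbVec q)
    {w : ℕ → Fin N} (hw : FreqReg w q) (f : Fin N → Fin K → ℝ) {p α : ℝ}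
    (hα : ∑ j, q j * ∑ i, gibbsVec p (f j) i * f j i = α) :
    htop (EwSet f w α) =
      ((∑ j, q j * Real.log (∑ i, Real.exp (p * (f j i - α))) : ℝ) : EReal) := by
  set h := ∑ j, q j * Real.log (∑ i, Real.exp (p * (f j i - α))) with hh
  obtain ⟨μ, hμ, hcyl⟩ := exists_gibbs_measure hw f hα
  have hne : (EwSet f w α).Nonempty := by
    by_contra! h0
    simp [h0] at hμ
  have hrate := fun x (hx : x ∈ EwSet f w α) => tendsto_log_gibbs_of_mem_EwSet hq hw f p α hx
  have hprob := fun k => probVec_gibbsVec p (f (w k))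
  have hnonneg : 0 ≤ h := by
    obtain ⟨x, hx⟩ := hne
    refine neg_nonpos.1 (le_of_tendsto (hrate x hx) (.of_forall fun n => ?_))
    refine div_nonpos_of_nonpos_of_nonneg (Real.exp_le_one_iff.1 ?_) n.cast_nonneg
    rw [← prod_gibbsVec p (fun k => f (w k))]
    refine Finset.prod_le_one (fun k _ => (hprob k).1 _) fun k _ => ?_
    rw [← (hprob k).2]
    exact Finset.single_le_sum (fun i _ => (hprob k).1 i) (Finset.mem_univ _)
  have hlower : ∀ t < h, Hentm (EwSet f w α) t = ⊤ := by
    intro t ht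
    obtain ⟨s, hts, hsh⟩ := exists_between ht
    refine Hentm_eq_top_of_measure_le μ hμ hts fun x hx => ?_
    filter_upwards [(hrate x hx).eventually_lt_const (neg_lt_neg hsh), eventually_gt_atTop 0]
      with n hn hn0
    rw [hcyl, prod_gibbsVec p (fun k => f (w k))]
    rw [div_lt_iff₀ (Nat.cast_pos.2 hn0)] at hn
    exact ENNReal.ofReal_le_ofReal (Real.exp_le_exp.2 hn.le)
  have hupper : ∀ t > h, Hentm (EwSet f w α) t ≠ ⊤ := by
    intro t ht
    obtain ⟨s, hhs, hst⟩ := exists_between ht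
    refine Hentm_ne_top_of_le_prod (fun k => (hprob k).1) (fun k => (hprob k).2) hst
      fun x hx r => ?_
    obtain ⟨n, hn, hnr⟩ := (((hrate x hx).eventually_const_lt (neg_lt_neg hhs)).and
      (eventually_gt_atTop r)).exists
    refine ⟨n, hnr, ?_⟩
    rw [prod_gibbsVec p (fun k => f (w k))]
    rw [lt_div_iff₀ (Nat.cast_pos.2 (by lia))] at hn
    exact Real.exp_le_exp.2 hn.le
  rw [htop, if_neg hne.ne_empty, EReal.coe_eq_coe_iff]
  refine csInf_eq_of_forall_ge_of_forall_gt_exists_lt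
    ⟨h + 1, by linarith, hupper _ (by linarith)⟩ (fun t ht => ?_) fun t ht => ?_
  · by_contra! hlt
    exact ht.2 (hlower t hlt)
  · obtain ⟨s, hhs, hst⟩ := exists_between ht
    exact ⟨s, ⟨hnonneg.trans hhs.le, hupper s hhs⟩, hst⟩

lemma sum_gibbsVec_eq_phiDeriv {N K : ℕ} (q lam : Fin N → ℝ) (φ : Fin K → ℝ) (p : ℝ) :
    ∑ j, q j * ∑ i, gibbsVec p (fun i => lam j * φ i) i * (lam j * φ i) =
      PhiDeriv q lam φ p := by
  simp only [PhiDeriv, gibbsVec, Finset.sum_div, Finset.mul_sum]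
  exact Finset.sum_congr rfl fun j _ => Finset.sum_congr rfl fun i _ => by ring

theorem weighted_spectrum_explicit_formula
    {N K : ℕ} (q : Fin N → ℝ) (hq : ProbVec q)
    (w : ℕ → Fin N) (hw : FreqReg w q)
    (lam : Fin N → ℝ) (φ : Fin K → ℝ)
    (hφ : phiMax φ ≠ phiMin φ) :
    (∀ α ∈ interior (Set.Icc (loEnd q lam φ) (hiEnd q lam φ)),
      (∃! p : ℝ, PhiDeriv q lam φ p = α) ∧
      ∀ p : ℝ, PhiDeriv q lam φ p = α →
        htop (EwSet (fun j i => lam j * φ i) w α) =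
          ((∑ j, q j * Real.log (∑ i, Real.exp (p * (lam j * φ i - α))) : ℝ) : EReal)) ∧
    ∀ α : ℝ, α ∉ Set.Icc (loEnd q lam φ) (hiEnd q lam φ) →
      (⨅ p : ℝ, ((∑ j, q j * Real.log (∑ i, Real.exp (p * (lam j * φ i - α))) : ℝ) : EReal))
        = ⊥ := by
  have := neZero_of_phiMax_ne_phiMin hφ
  refine ⟨fun α hα => ⟨existsUnique_phiDeriv_eq hq.1 hφ (by rwa [interior_Icc] at hα),
    fun p hp => ?_⟩, fun α hα => iInf_pressure_eq_bot hq φ hα⟩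
  exact htop_EwSet_eq hq hw (fun j i => lam j * φ i)
    ((sum_gibbsVec_eq_phiDeriv q lam φ p).trans hp)
end

section
/- Let E ⊆ Γ = Ω × Σ and let ν be a Borel probability measure on Ω for which there exist c > 0 and s > 0 such that ν([𝐰|_n]) ≤ c·e^{−ns} for every 𝐰 ∈ Ω and every n ≥ 1. Then for ν-almost every 𝐰 ∈ Ω, h_top(E ∩ ξ(𝐰)) ≤ max{h_top(E) − s, 0}, where E ∩ ξ(𝐰) is identified with a subset of Σ. -/
open Filter Set
open scoped ENNReal

open MeasureTheory

/-- The product space `Γ = Ω × Σ`. -/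
abbrev GaSp (N K : ℕ) := (ℕ → Fin N) × (ℕ → Fin K)

/-- The simultaneous left shift on `Γ`. -/
def shift2 {N K : ℕ} (p : GaSp N K) : GaSp N K := (shift p.1, shift p.2)

/-- Cylinder in `Γ` given by a pair of words of equal length. -/
def cylP {N K : ℕ} {n : ℕ} (w : Fin n → Fin N) (v : Fin n → Fin K) : Set (GaSp N K) :=
  {p | (∀ k : Fin n, p.1 (k : ℕ) = w k) ∧ (∀ k : Fin n, p.2 (k : ℕ) = v k)}

/-- Cylinder determined by a `List` word (used for concatenations). -/
def cylL {α : Type*} (w : List α) : Set (ℕ → α) :=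
  {x | ∀ (k : ℕ) (h : k < w.length), x k = w.get ⟨k, h⟩}

/-- `ν` is quasi-Bernoulli. -/
def QuasiBernoulli {N : ℕ} (ν : Measure (ℕ → Fin N)) : Prop :=
  ∃ C : ℝ≥0∞, 0 < C ∧ C ≠ ⊤ ∧ ∀ w z : List (Fin N),
    C⁻¹ * (ν (cylL w) * ν (cylL z)) ≤ ν (cylL (w ++ z)) ∧
    ν (cylL (w ++ z)) ≤ C * (ν (cylL w) * ν (cylL z))

/-- Birkhoff sums `S_n g` on `Γ`. -/
noncomputable def SnS {N K : ℕ} (g : GaSp N K → ℝ) (n : ℕ) (p : GaSp N K) : ℝ :=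
  ∑ k ∈ Finset.range n, g (shift2^[k] p)

/-- The fiberwise partition function
`Z_n(g,𝐰) = Σ_{𝐢∈Σ_{A,n}} sup_{𝐣∈[𝐢]} e^{S_n g(𝐰,𝐣)}`
(words with no admissible extension contribute `sSup ∅ = 0`). -/
noncomputable def Zn {N K : ℕ} (M : Fin K → Fin K → Bool) (g : GaSp N K → ℝ)
    (w : ℕ → Fin N) (n : ℕ) : ℝ :=
  ∑ v : Fin n → Fin K,
    sSup ((fun j => Real.exp (SnS g n (w, j))) ''
      {j | j ∈ SigmaA M ∧ ∀ k : Fin n, j (k : ℕ) = v k})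

/-- The conditional pressure `P_ν(g) = lim (1/n) ∫ log Z_n(g,𝐰) dν(𝐰)`
(realized as a `limsup`; the limit exists in the situations considered). -/
noncomputable def condPressure {N K : ℕ} (M : Fin K → Fin K → Bool)
    (ν : Measure (ℕ → Fin N)) (g : GaSp N K → ℝ) : ℝ :=
  Filter.limsup (fun n : ℕ => (∫ w, Real.log (Zn M g w n) ∂ν) / n) Filter.atTop

/-- `g : Γ_A → E` has bounded variation:
`Σ_k max_{(𝐰,𝐢)∧(𝐳,𝐣) = k} ‖g(𝐰,𝐢) − g(𝐳,𝐣)‖ < ∞`. -/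
def BddVar {N K : ℕ} {E : Type*} [NormedAddCommGroup E] (M : Fin K → Fin K → Bool)
    (g : GaSp N K → E) : Prop :=
  ∃ B : ℝ, ∀ m : ℕ,
    ∑ k ∈ Finset.range m,
      sSup {d : ℝ | ∃ p q : GaSp N K, p.2 ∈ SigmaA M ∧ q.2 ∈ SigmaA M ∧
        (∀ t < k, p.1 t = q.1 t) ∧ (∀ t < k, p.2 t = q.2 t) ∧ d = ‖g p - g q‖} ≤ B

/-- `-x log x` (with the convention `0 · log 0 = 0`). -/
noncomputable def nlog (x : ℝ) : ℝ := -(x * Real.log x)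

/-- The Kolmogorov–Sinai entropy of a shift-invariant measure on `Ω`,
computed through cylinders (realized as a `limsup`; the limit exists by
subadditivity). -/
noncomputable def entOm {N : ℕ} (ν : Measure (ℕ → Fin N)) : ℝ :=
  Filter.limsup
    (fun n : ℕ => (∑ w : Fin n → Fin N, nlog ((ν (cyl w)).toReal)) / n) Filter.atTop

/-- The Kolmogorov–Sinai entropy of a shift-invariant measure on `Γ`,
computed through cylinders. -/
noncomputable def entGa {N K : ℕ} (μ : Measure (GaSp N K)) : ℝ :=
  Filter.limsup
    (fun n : ℕ =>
      (∑ w : Fin n → Fin N, ∑ v : Fin n → Fin K, nlog ((μ (cylP w v)).toReal)) / n)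
    Filter.atTop

/-- `μ ∈ M_ν(Γ_A)`: a shift-invariant probability measure on `Γ_A` with
marginal `ν`. -/
def MemMnu {N K : ℕ} (M : Fin K → Fin K → Bool) (ν : Measure (ℕ → Fin N))
    (μ : Measure (GaSp N K)) : Prop :=
  IsProbabilityMeasure μ ∧ MeasurePreserving shift2 μ μ ∧
    μ.map Prod.fst = ν ∧ μ {p | p.2 ∈ SigmaA M} = 1

/-- Cylinder in `Γ` of a word over the product alphabet. -/
def cylPair {N K : ℕ} {n : ℕ} (w : Fin n → Fin N × Fin K) : Set (GaSp N K) :=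
  {p | ∀ k : Fin n, p.1 (k : ℕ) = (w k).1 ∧ p.2 (k : ℕ) = (w k).2}

/-- Finite words over the product alphabet. -/
def WordP (N K : ℕ) : Type := Σ n : ℕ, Fin n → Fin N × Fin K

def WordP.len {N K : ℕ} (w : WordP N K) : ℕ := w.1

def WordP.cylSet {N K : ℕ} (w : WordP N K) : Set (GaSp N K) := cylPair w.2

/-- `H^s_r` for subsets of `Γ`. -/
noncomputable def HsrP {N K : ℕ} (E : Set (GaSp N K)) (s : ℝ) (r : ℕ) : ℝ≥0∞ :=
  ⨅ (S : Set (WordP N K)) (_ : ∀ w ∈ S, r < w.len) (_ : E ⊆ ⋃ w ∈ S, w.cylSet),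
    ∑' w : S, ENNReal.ofReal (Real.exp (-s * ((w : WordP N K).len : ℝ)))

noncomputable def HentmP {N K : ℕ} (E : Set (GaSp N K)) (s : ℝ) : ℝ≥0∞ :=
  ⨆ r : ℕ, HsrP E s r

open scoped Classical in
/-- Topological entropy for subsets of `Γ`, with `htopP ∅ = -∞`. -/
noncomputable def htopP {N K : ℕ} (E : Set (GaSp N K)) : EReal :=
  if E = ∅ then ⊥ else ((sInf {s : ℝ | 0 ≤ s ∧ HentmP E s ≠ ⊤} : ℝ) : EReal)

/-- The `Ω`-component of a word over the product alphabet. -/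
def WordP.fstWord {N K : ℕ} (C : WordP N K) : Word (Fin N) := ⟨C.1, fun k => (C.2 k).1⟩

/-- The `Σ`-component of a word over the product alphabet. -/
def WordP.sndWord {N K : ℕ} (C : WordP N K) : Word (Fin K) := ⟨C.1, fun k => (C.2 k).2⟩

instance WordP.instCountable {N K : ℕ} : Countable (WordP N K) :=
  inferInstanceAs (Countable (Σ n : ℕ, Fin n → Fin N × Fin K))

lemma Word.measurableSet_cylSet {N : ℕ} (w : Word (Fin N)) : MeasurableSet w.cylSet := by
  have : w.cylSet = ⋂ k : Fin w.1, (fun x : ℕ → Fin N => x k) ⁻¹' {w.2 k} := by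
    ext x
    simp [Word.cylSet, cyl]
  rw [this]
  exact MeasurableSet.iInter fun k => measurable_pi_apply _ (measurableSet_singleton _)

lemma measure_cylSet_le {N : ℕ} {ν : Measure (ℕ → Fin N)} {c s : ℝ}
    (hν : ∀ (w : ℕ → Fin N) (n : ℕ), 1 ≤ n →
      ν {x : ℕ → Fin N | ∀ k < n, x k = w k} ≤ ENNReal.ofReal (c * Real.exp (-(n : ℝ) * s)))
    (w : Word (Fin N)) (hw : 1 ≤ w.len) :
    ν w.cylSet ≤ ENNReal.ofReal (c * Real.exp (-(w.len : ℝ) * s)) := by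
  rcases w.cylSet.eq_empty_or_nonempty with h | ⟨x, hx⟩
  · simp [h]
  · refine (measure_mono fun y hy => ?_).trans (hν x w.len hw)
    intro k hk
    exact (hy ⟨k, hk⟩).trans (hx ⟨k, hk⟩).symm

lemma Hsr_le_tsum {α : Type*} {E : Set (ℕ → α)} (u : ℝ) {r : ℕ} {S : Set (Word α)}
    (hS : ∀ w ∈ S, r < w.len) (hE : E ⊆ ⋃ w ∈ S, w.cylSet) :
    Hsr E u r ≤ ∑' w : S, ENNReal.ofReal (Real.exp (-u * ((w : Word α).len : ℝ))) :=
  iInf_le_of_le S <| iInf_le_of_le hS <| iInf_le_of_le hE le_rfl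

lemma HsrP_le_tsum {N K : ℕ} {E : Set (GaSp N K)} (u : ℝ) {r : ℕ} {S : Set (WordP N K)}
    (hS : ∀ w ∈ S, r < w.len) (hE : E ⊆ ⋃ w ∈ S, w.cylSet) :
    HsrP E u r ≤ ∑' w : S, ENNReal.ofReal (Real.exp (-u * ((w : WordP N K).len : ℝ))) :=
  iInf_le_of_le S <| iInf_le_of_le hS <| iInf_le_of_le hE le_rfl

lemma Hsr_mono_level {α : Type*} (E : Set (ℕ → α)) (u : ℝ) {r m : ℕ} (h : r ≤ m) :
    Hsr E u r ≤ Hsr E u m :=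
  le_iInf fun _ => le_iInf fun hS => le_iInf fun hE =>
    Hsr_le_tsum u (fun w hw => h.trans_lt (hS w hw)) hE

lemma HentmP_antitone {N K : ℕ} (E : Set (GaSp N K)) {t t' : ℝ} (h : t ≤ t') :
    HentmP E t' ≤ HentmP E t := by
  refine iSup_mono fun r => iInf_mono fun S => iInf_mono fun _ => iInf_mono fun _ =>
    ENNReal.tsum_le_tsum fun w => ENNReal.ofReal_le_ofReal (Real.exp_le_exp.2 ?_)
  have : (0 : ℝ) ≤ (w : WordP N K).len := Nat.cast_nonneg _
  nlinarith

/-- A cover of `E` by cylinders of `Γ` induces a cover of each fiber. -/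
lemma Hsr_fiber_le {N K : ℕ} (E : Set (GaSp N K)) (u : ℝ) {r : ℕ} {S : Set (WordP N K)}
    (hS : ∀ C ∈ S, r < C.len) (hE : E ⊆ ⋃ C ∈ S, C.cylSet) (w : ℕ → Fin N) :
    Hsr {j : ℕ → Fin K | (w, j) ∈ E} u r ≤
      ∑' C : S, (C : WordP N K).fstWord.cylSet.indicator
        (fun _ => ENNReal.ofReal (Real.exp (-u * ((C : WordP N K).len : ℝ)))) w := by
  classical
  set T : Set S := {C | w ∈ (C : WordP N K).fstWord.cylSet} with hT
  let p : S → Word (Fin K) := fun C => (C : WordP N K).sndWord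
  have hcover : {j : ℕ → Fin K | (w, j) ∈ E} ⊆ ⋃ v ∈ p '' T, v.cylSet := by
    intro j hj
    obtain ⟨C, hC, hwj⟩ := mem_iUnion₂.1 (hE hj)
    exact mem_iUnion₂.2 ⟨C.sndWord, ⟨⟨C, hC⟩, fun k => (hwj k).1, rfl⟩, fun k => (hwj k).2⟩
  have hlen : ∀ v ∈ p '' T, r < v.len := by
    rintro _ ⟨C, -, rfl⟩
    exact hS C C.2
  refine (Hsr_le_tsum u hlen hcover).trans ?_
  refine (ENNReal.tsum_le_tsum_comp_of_surjective (imageFactorization_surjective (f := p) (s := T))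
    (fun v : p '' T => ENNReal.ofReal (Real.exp (-u * ((v : Word (Fin K)).len : ℝ))))).trans ?_
  refine (tsum_subtype T
    (fun C : S => ENNReal.ofReal (Real.exp (-u * ((C : WordP N K).len : ℝ))))).le.trans ?_
  exact ENNReal.tsum_le_tsum fun C => by simp [indicator, hT]

lemma ae_Hentm_fiber_ne_top {N K : ℕ} (E : Set (GaSp N K)) {ν : Measure (ℕ → Fin N)} {c s t : ℝ}
    (hc : 0 ≤ c)
    (hν : ∀ (w : ℕ → Fin N) (n : ℕ), 1 ≤ n →
      ν {x : ℕ → Fin N | ∀ k < n, x k = w k} ≤ ENNReal.ofReal (c * Real.exp (-(n : ℝ) * s)))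
    (ht : HentmP E t ≠ ⊤) :
    ∀ᵐ w ∂ν, Hentm {j : ℕ → Fin K | (w, j) ∈ E} (t - s) ≠ ⊤ := by
  have hcov : ∀ r : ℕ, ∃ S : Set (WordP N K), (∀ C ∈ S, r < C.len) ∧ (E ⊆ ⋃ C ∈ S, C.cylSet) ∧
      ∑' C : S, ENNReal.ofReal (Real.exp (-t * ((C : WordP N K).len : ℝ))) <
        HentmP E t + 1 := by
    intro r
    have : HsrP E t r < HentmP E t + 1 :=
      (le_iSup (HsrP E t) r).trans_lt (ENNReal.lt_add_right ht one_ne_zero)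
    simpa only [HsrP, iInf_lt_iff, exists_prop] using this
  choose S hlen hE hsum using hcov
  let f : ℕ → (ℕ → Fin N) → ℝ≥0∞ := fun r w =>
    ∑' C : S r, (C : WordP N K).fstWord.cylSet.indicator
      (fun _ => ENNReal.ofReal (Real.exp (-(t - s) * ((C : WordP N K).len : ℝ)))) w
  have hind : ∀ r, ∀ C : S r, Measurable ((C : WordP N K).fstWord.cylSet.indicator
      fun _ => ENNReal.ofReal (Real.exp (-(t - s) * ((C : WordP N K).len : ℝ)))) := fun r C =>
    measurable_const.indicator (Word.measurableSet_cylSet _)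
  have hf : ∀ r, Measurable (f r) := fun r => Measurable.tsum (hind r)
  have hint : ∀ r, ∫⁻ w, f r w ∂ν ≤ ENNReal.ofReal c * (HentmP E t + 1) := by
    intro r
    rw [lintegral_tsum fun C => (hind r C).aemeasurable]
    refine le_trans ?_ (mul_le_mul_right (hsum r).le _)
    rw [← ENNReal.tsum_mul_left]
    refine ENNReal.tsum_le_tsum fun C => ?_
    rw [lintegral_indicator_const (Word.measurableSet_cylSet _)]
    have hC : 1 ≤ (C : WordP N K).fstWord.len := (Nat.zero_le r).trans_lt (hlen r C C.2)
    refine (mul_le_mul_right (measure_cylSet_le hν _ hC) _).trans ?_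
    rw [← ENNReal.ofReal_mul (Real.exp_pos _).le, ← ENNReal.ofReal_mul hc, mul_left_comm,
      ← Real.exp_add]
    refine le_of_eq (congrArg (fun x => ENNReal.ofReal (c * Real.exp x)) ?_)
    change -(t - s) * ((C : WordP N K).len : ℝ) + -((C : WordP N K).len : ℝ) * s = _
    ring
  have hlim : ∫⁻ w, liminf (fun r => f r w) atTop ∂ν ≠ ⊤ := by
    refine ((lintegral_liminf_le hf).trans_lt ?_).ne
    refine (liminf_le_of_le (a := ENNReal.ofReal c * (HentmP E t + 1)) (by isBoundedDefault)
      fun b hb => ?_).trans_lt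
        (ENNReal.mul_lt_top ENNReal.ofReal_lt_top (ENNReal.add_lt_top.2 ⟨ht.lt_top, by simp⟩))
    obtain ⟨r, hr⟩ := hb.exists
    exact hr.trans (hint r)
  filter_upwards [ae_lt_top (Measurable.liminf hf) hlim] with w hw
  refine (lt_of_le_of_lt (iSup_le fun r => ?_) hw).ne
  refine le_liminf_of_le (by isBoundedDefault) ?_
  filter_upwards [eventually_ge_atTop r] with m hm
  exact (Hsr_mono_level _ _ hm).trans (Hsr_fiber_le E _ (hlen m) (hE m) w)

/-- The full shift has finite entropy, so that `htopP` is the infimum of a nonempty set. -/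
lemma exists_HentmP_ne_top {N K : ℕ} (E : Set (GaSp N K)) :
    ∃ t : ℝ, 0 ≤ t ∧ HentmP E t ≠ ⊤ := by
  have hM : (0 : ℝ) < (N * K : ℕ) + 1 := by positivity
  refine ⟨Real.log ((N * K : ℕ) + 1), Real.log_nonneg (by linarith [Nat.cast_nonneg (α := ℝ) (N * K)]), ?_⟩
  refine ((iSup_le fun r => ?_ : _ ≤ (1 : ℝ≥0∞)).trans_lt ENNReal.one_lt_top).ne
  let q : (Fin (r + 1) → Fin N × Fin K) → WordP N K := fun a => ⟨r + 1, a⟩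
  have hcover : E ⊆ ⋃ C ∈ range q, C.cylSet := fun p _ =>
    mem_iUnion₂.2 ⟨q fun k => (p.1 k, p.2 k), mem_range_self _, fun k => ⟨rfl, rfl⟩⟩
  have hlen : ∀ C ∈ range q, r < C.len := by
    rintro _ ⟨a, rfl⟩
    exact Nat.lt_succ_self r
  refine (HsrP_le_tsum _ hlen hcover).trans ?_
  refine (ENNReal.tsum_le_tsum_comp_of_surjective (rangeFactorization_surjective (f := q))
    (fun C : range q => ENNReal.ofReal
      (Real.exp (-Real.log ((N * K : ℕ) + 1) * ((C : WordP N K).len : ℝ))))).trans ?_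
  have hterm : ∀ a, ENNReal.ofReal (Real.exp (-Real.log ((N * K : ℕ) + 1) *
      ((rangeFactorization q a : WordP N K).len : ℝ))) =
      ENNReal.ofReal ((((N * K : ℕ) + 1 : ℝ) ^ (r + 1))⁻¹) := by
    intro a
    change ENNReal.ofReal (Real.exp (-Real.log ((N * K : ℕ) + 1) * ((r + 1 : ℕ) : ℝ))) = _
    rw [neg_mul, Real.exp_neg, mul_comm, Real.exp_nat_mul, Real.exp_log hM]
  simp only [hterm]
  rw [tsum_fintype, Finset.sum_const, nsmul_eq_mul, ← ENNReal.ofReal_natCast,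
    ← ENNReal.ofReal_mul (by positivity), ENNReal.ofReal_le_one, ← div_eq_mul_inv]
  refine div_le_one_of_le₀ ?_ (by positivity)
  simp only [Finset.card_univ, Fintype.card_fun, Fintype.card_prod, Fintype.card_fin]
  push_cast
  gcongr
  linarith

lemma htop_le_of_Hentm_ne_top {α : Type*} {F : Set (ℕ → α)} {u : ℝ} (hu : 0 ≤ u)
    (hF : Hentm F u ≠ ⊤) : htop F ≤ (u : EReal) := by
  unfold htop
  split_ifs
  · exact bot_le
  · exact EReal.coe_le_coe_iff.2 (csInf_le ⟨0, fun _ h => h.1⟩ ⟨hu, hF⟩)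

theorem slicing_theorem_for_entropy
    {N K : ℕ} (E : Set (GaSp N K))
    (ν : Measure (ℕ → Fin N)) [IsProbabilityMeasure ν]
    (c s : ℝ) (hc : 0 < c) (hs : 0 < s)
    (hν : ∀ (w : ℕ → Fin N) (n : ℕ), 1 ≤ n →
      ν {x : ℕ → Fin N | ∀ k < n, x k = w k} ≤ ENNReal.ofReal (c * Real.exp (-(n : ℝ) * s))) :
    ∀ᵐ w ∂ν, htop {j : ℕ → Fin K | (w, j) ∈ E} ≤ max (htopP E - (s : EReal)) 0 := by
  rcases eq_or_ne E ∅ with rfl | hE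
  · simp [htop]
  set h : ℝ := sInf {t : ℝ | 0 ≤ t ∧ HentmP E t ≠ ⊤}
  have hP : htopP E = (h : EReal) := by rw [htopP, if_neg hE]
  have hstep : ∀ n : ℕ, ∀ᵐ w ∂ν, htop {j : ℕ → Fin K | (w, j) ∈ E} ≤
      ((max (h - s) 0 + 1 / ((n : ℝ) + 1) : ℝ) : EReal) := by
    intro n
    have hn : (0 : ℝ) < 1 / ((n : ℝ) + 1) := Nat.one_div_pos_of_nat
    have hlt : h < max (h - s) 0 + 1 / ((n : ℝ) + 1) + s := by
      linarith [le_max_left (h - s) 0]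
    obtain ⟨t, ⟨-, ht⟩, htlt⟩ := exists_lt_of_csInf_lt (exists_HentmP_ne_top E) hlt
    have hfin := ne_top_of_le_ne_top ht (HentmP_antitone E htlt.le)
    filter_upwards [ae_Hentm_fiber_ne_top E hc.le hν hfin] with w hw
    rw [add_sub_cancel_right] at hw
    exact htop_le_of_Hentm_ne_top (add_nonneg (le_max_right _ _) hn.le) hw
  filter_upwards [ae_all_iff.2 hstep] with w hw
  have hmax : max (htopP E - (s : EReal)) 0 = ((max (h - s) 0 : ℝ) : EReal) := by
    rw [hP, EReal.coe_strictMono.monotone.map_max, EReal.coe_sub, EReal.coe_zero]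
  rw [hmax]
  refine ge_of_tendsto' (x := atTop)
    (f := fun n : ℕ => ((max (h - s) 0 + 1 / ((n : ℝ) + 1) : ℝ) : EReal)) ?_ hw
  refine (continuous_coe_real_ereal.tendsto _).comp ?_
  simpa using tendsto_one_div_add_atTop_nhds_zero_nat.const_add (max (h - s) 0)
end
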